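/- Let g ∈ ℤ[x] be x²-divisible of degree d and let c ∈ ℚ. If |g_c^{n'}(c)| ≥ max{4L_g, |c|} for some n' ≥ 0, then for every n ≥ n' one has |g_c^n(c)| ≥ 2^{−(d^{n−n'}−1)/(d−1)} · |g_c^{n'}(c)|^{d^{n−n'}}. -/

import Mathlib

open Polynomial

/-- The `n`-th iterate of `g_c := g + c` applied to `0`, for `g ∈ ℤ[x]` and `c ∈ ℚ`. -/
noncomputable def gcIter (g : ℤ[X]) (c : ℚ) (n : ℕ) : ℚ :=
  (fun x : ℚ => (g.map (Int.castRingHom ℚ)).eval x + c)^[n] 0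

/-- `g` is `x²`-divisible: degree at least 2 and zero constant and linear coefficients. -/
def IsX2Divisible (g : ℤ[X]) : Prop :=
  2 ≤ g.natDegree ∧ g.coeff 0 = 0 ∧ g.coeff 1 = 0

/-- The length `L_g = 1 + ∑_{i=2}^{d-1} |u_i|/|u_d|` of an `x²`-divisible polynomial. -/
noncomputable def Lg (g : ℤ[X]) : ℝ :=
  1 + ∑ i ∈ Finset.Ico 2 g.natDegree, (|g.coeff i| : ℝ) / (|g.leadingCoeff| : ℝ)

/-- `S_g`: the set of `c ∈ ℚ` such that the sequence `{g_c^n(0)}_{n ≥ 1}` takes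
infinitely many values. -/
def Sg (g : ℤ[X]) : Set ℚ :=
  {c : ℚ | (Set.range fun n : ℕ => gcIter g c (n + 1)).Infinite}

/-- The numerator `A_n` of `g_c^{n+1}(0) = g_c^n(c) = A_n / B_n` in lowest terms. -/
noncomputable def An (g : ℤ[X]) (c : ℚ) (n : ℕ) : ℤ := (gcIter g c (n + 1)).num

/-- The (positive) denominator `B_n` of `g_c^{n+1}(0) = g_c^n(c) = A_n / B_n`
in lowest terms. -/
noncomputable def Bn (g : ℤ[X]) (c : ℚ) (n : ℕ) : ℕ := (gcIter g c (n + 1)).den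

/-- For a natural number `a`, the factor `â = ∏_{p ∈ I(a)} p^{val_p(a)}`, where
`I(a)` consists of the primes `p` with `val_p(a) > val_p(u_d)`. -/
noncomputable def hatB (g : ℤ[X]) (a : ℕ) : ℕ :=
  ∏ p ∈ a.primeFactors.filter
      (fun p => padicValInt p g.leadingCoeff < padicValNat p a),
    p ^ padicValNat p a

/-- `g` has rapidly increasing numerators on `S`: there is an integer `N > 0` such that
for every `c ∈ S` there is a finite set `J_c ⊆ ℕ` with `#J_c ≤ N` such that for every
`n ≥ 1` outside `J_c` one has `ln |A_n| > ∑_{p ∣ n} ln |A_{n/p}|`. -/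
def RapidlyIncreasingNumerators (g : ℤ[X]) (S : Set ℚ) : Prop :=
  ∃ N : ℕ, 0 < N ∧ ∀ c ∈ S, ∃ J : Finset ℕ, J.card ≤ N ∧
    ∀ n : ℕ, 1 ≤ n → n ∉ J →
      (∑ p ∈ n.primeFactors, Real.log |(An g c (n / p) : ℝ)|) <
        Real.log |(An g c n : ℝ)|

/-- An `x²`-divisible integer polynomial maps `x` with `4 L_g ≤ |x|` and `|c| ≤ |x|` to a point
whose translate by `c` has absolute value at least `|x| ^ d / 2`. -/
lemma IsX2Divisible.abs_pow_div_two_le {g : ℤ[X]} (hg : IsX2Divisible g) {x c : ℝ}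
    (hL : 4 * Lg g ≤ |x|) (hc : |c| ≤ |x|) :
    |x| ^ g.natDegree / 2 ≤ |(g.map (Int.castRingHom ℝ)).eval x + c| := by
  obtain ⟨hd, h0, h1⟩ := hg
  have hlc : g.leadingCoeff ≠ 0 := by
    rw [Ne, leadingCoeff_eq_zero]
    rintro rfl
    simp at hd
  have hu : (1 : ℝ) ≤ |(g.leadingCoeff : ℝ)| := by
    exact_mod_cast Int.one_le_abs hlc
  set u : ℝ := |(g.leadingCoeff : ℝ)| with hu_def
  set S : ℝ := ∑ i ∈ Finset.Ico 2 g.natDegree, |(g.coeff i : ℝ)| with hS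
  have hSL : S = u * (Lg g - 1) := by
    rw [Lg, ← Finset.sum_div]
    field_simp
    ring
  have hS0 : 0 ≤ S := Finset.sum_nonneg fun _ _ => abs_nonneg _
  have hL1 : 1 ≤ Lg g := by
    by_contra! hlt
    nlinarith
  have hx4 : 4 ≤ |x| := by linarith
  have heval : (g.map (Int.castRingHom ℝ)).eval x =
      (∑ i ∈ Finset.Ico 2 g.natDegree, (g.coeff i : ℝ) * x ^ i) +
        (g.leadingCoeff : ℝ) * x ^ g.natDegree := by
    rw [eval_map, eval₂_eq_sum_range, Finset.sum_range_succ, Finset.range_eq_Ico,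
      ← Finset.sum_Ico_consecutive _ (Nat.zero_le 2) hd]
    simp [Finset.sum_Ico_eq_sum_range, Finset.sum_range_succ, h0, h1]
  obtain ⟨m, hm⟩ : ∃ m, g.natDegree = m + 2 := ⟨g.natDegree - 2, by omega⟩
  have hlow : |∑ i ∈ Finset.Ico 2 g.natDegree, (g.coeff i : ℝ) * x ^ i| ≤ S * |x| ^ (m + 1) := by
    refine (Finset.abs_sum_le_sum_abs _ _).trans ?_
    rw [hS, Finset.sum_mul]
    refine Finset.sum_le_sum fun i hi => ?_
    rw [abs_mul, abs_pow]
    have := (Finset.mem_Ico.mp hi).2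
    gcongr
    · linarith
    · omega
  have htri : u * |x| ^ g.natDegree - S * |x| ^ (m + 1) - |x| ≤
      |(g.map (Int.castRingHom ℝ)).eval x + c| := by
    rw [heval]
    set s := ∑ i ∈ Finset.Ico 2 g.natDegree, (g.coeff i : ℝ) * x ^ i
    have h2 : |(g.leadingCoeff : ℝ) * x ^ g.natDegree| = u * |x| ^ g.natDegree := by
      rw [abs_mul, abs_pow]
    have h3 : |(g.leadingCoeff : ℝ) * x ^ g.natDegree| ≤
        |s + (g.leadingCoeff : ℝ) * x ^ g.natDegree + c| + |s| + |c| := by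
      have h4 := abs_sub (s + (g.leadingCoeff : ℝ) * x ^ g.natDegree + c) (s + c)
      have h5 := abs_add_le s c
      rw [show s + (g.leadingCoeff : ℝ) * x ^ g.natDegree + c - (s + c) =
        (g.leadingCoeff : ℝ) * x ^ g.natDegree by ring] at h4
      linarith
    linarith
  refine le_trans ?_ htri
  have hp : 1 ≤ |x| ^ m := one_le_pow₀ (by linarith)
  have hSx : S ≤ u * (|x| / 4) := by
    rw [hSL]
    gcongr
    linarith
  have hSp : S * |x| ^ (m + 1) ≤ u * (|x| / 4) * |x| ^ (m + 1) := by gcongr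
  have hup : 1 * |x| ^ (m + 2) ≤ u * |x| ^ (m + 2) := by gcongr
  have hxp : |x| ≤ |x| ^ (m + 2) / 4 := by
    have : |x| * 4 * 1 ≤ |x| * |x| * |x| ^ m := by gcongr
    rw [pow_add]
    linarith
  have hring : u * (|x| / 4) * |x| ^ (m + 1) = u * |x| ^ (m + 2) / 4 := by ring
  rw [hm]
  linarith

lemma gcIter_succ (g : ℤ[X]) (c : ℚ) (n : ℕ) :
    (gcIter g c (n + 1) : ℝ) =
      (g.map (Int.castRingHom ℝ)).eval (gcIter g c n : ℝ) + (c : ℝ) := by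
  rw [gcIter, Function.iterate_succ_apply', ← gcIter]
  push_cast
  congr 1
  simp [eval_map, eval₂_eq_sum_range]

/-- A real sequence with `a (k + 1) ≥ a k ^ d / 2` satisfies
`a k ≥ a 0 ^ (d ^ k) / 2 ^ (1 + d + ⋯ + d ^ (k - 1))`. -/
lemma pow_div_two_pow_geom_sum_le {a : ℕ → ℝ} {d : ℕ} (h0 : 0 ≤ a 0)
    (ha : ∀ k, a k ^ d / 2 ≤ a (k + 1)) (k : ℕ) :
    a 0 ^ d ^ k / 2 ^ (∑ i ∈ Finset.range k, d ^ i) ≤ a k := by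
  induction k with
  | zero => simp
  | succ k ih =>
    calc a 0 ^ d ^ (k + 1) / 2 ^ (∑ i ∈ Finset.range (k + 1), d ^ i)
        = (a 0 ^ d ^ k / 2 ^ (∑ i ∈ Finset.range k, d ^ i)) ^ d / 2 := by
          rw [geom_sum_succ, div_pow, ← pow_mul, ← pow_mul, ← pow_succ, div_div, ← pow_succ,
            mul_comm d]
      _ ≤ a k ^ d / 2 := by gcongr
      _ ≤ a (k + 1) := ha k

/-- Lemma 2.12: if `|g_c^{n'}(c)| ≥ max{4L_g, |c|}`, then for every `n ≥ n'` one has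
`|g_c^n(c)| ≥ 2^{−(d^{n−n'}−1)/(d−1)} · |g_c^{n'}(c)|^{d^{n−n'}}`. -/
theorem iterate_abs_growth (g : ℤ[X]) (hg : IsX2Divisible g) (c : ℚ) (n' : ℕ)
    (h : max (4 * Lg g) |(c : ℝ)| ≤ |(gcIter g c (n' + 1) : ℝ)|)
    (n : ℕ) (hn : n' ≤ n) :
    (2 : ℝ) ^ (-(((g.natDegree : ℝ) ^ (n - n') - 1) / ((g.natDegree : ℝ) - 1))) *
        |(gcIter g c (n' + 1) : ℝ)| ^ (g.natDegree ^ (n - n')) ≤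
      |(gcIter g c (n + 1) : ℝ)| := by
  obtain ⟨k, rfl⟩ := Nat.exists_eq_add_of_le hn
  obtain ⟨hL, hc⟩ := max_le_iff.mp h
  set a : ℕ → ℝ := fun k => |(gcIter g c (n' + k + 1) : ℝ)| with ha
  have step : ∀ k, a 0 ≤ a k → a k ^ g.natDegree / 2 ≤ a (k + 1) := fun k hk => by
    have := hg.abs_pow_div_two_le (hL.trans hk) (hc.trans hk)
    rwa [← gcIter_succ] at this
  have hL1 : 1 ≤ Lg g := le_add_of_nonneg_right (Finset.sum_nonneg fun _ _ => by positivity)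
  have ha0 : 4 ≤ a 0 := le_trans (by linarith) hL
  have mono : ∀ k, a 0 ≤ a k := fun k => by
    induction k with
    | zero => exact le_rfl
    | succ k ih =>
      have h1 := step k ih
      have h2 : a k ^ 2 ≤ a k ^ g.natDegree := pow_le_pow_right₀ (by linarith) hg.1
      nlinarith
  have key := pow_div_two_pow_geom_sum_le (by linarith) (fun k => step k (mono k)) k
  have hd : (g.natDegree : ℝ) ≠ 1 := by
    have := hg.1
    exact_mod_cast (by omega : g.natDegree ≠ 1)
  rw [Nat.add_sub_cancel_left, ← geom_sum_eq hd, Real.rpow_neg zero_le_two, inv_mul_eq_div]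
  convert key using 2
  exact_mod_cast Real.rpow_natCast 2 (∑ i ∈ Finset.range k, g.natDegree ^ i)
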